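/- arXiv:1802.00238 — 2 statements merged into one kernel-verified Lean document; each statement's English description precedes it below -/
import Mathlib

section
/- Let X and Y be complex Banach spaces and let P : 𝓕(X) → Y be an orthogonally additive n-homogeneous polynomial on the algebra 𝓕(X) of finite-rank operators. Then there exists a unique linear map Φ : 𝓕(X) → Y such that P(T) = Φ(Tⁿ) for every T ∈ 𝓕(X). (No continuity of P or Φ is assumed or asserted.) -/
/-- The (non-closed, non-unital) algebra `𝓕(X)` of finite-rank bounded
operators on `X`, as a submodule of `X →L[ℂ] X` (it is moreover closed under
multiplication in `X →L[ℂ] X`). -/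
noncomputable def FinRankOps (X : Type*) [NormedAddCommGroup X] [NormedSpace ℂ X] :
    Submodule ℂ (X →L[ℂ] X) where
  carrier := {T | FiniteDimensional ℂ (LinearMap.range (T : X →ₗ[ℂ] X))}
  add_mem' := by
    intro a b ha hb
    have h : LinearMap.range ((a + b : X →L[ℂ] X) : X →ₗ[ℂ] X) ≤
        LinearMap.range ((a : X →L[ℂ] X) : X →ₗ[ℂ] X) ⊔
        LinearMap.range ((b : X →L[ℂ] X) : X →ₗ[ℂ] X) := by
      rintro x ⟨y, rfl⟩
      exact Submodule.mem_sup.2 ⟨a y, ⟨y, rfl⟩, b y, ⟨y, rfl⟩, by simp⟩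
    haveI : FiniteDimensional ℂ (LinearMap.range ((a : X →L[ℂ] X) : X →ₗ[ℂ] X)) := ha
    haveI : FiniteDimensional ℂ (LinearMap.range ((b : X →L[ℂ] X) : X →ₗ[ℂ] X)) := hb
    exact Submodule.finiteDimensional_of_le h
  zero_mem' := by
    simp only [Set.mem_setOf_eq]
    rw [show ((0 : X →L[ℂ] X) : X →ₗ[ℂ] X) = 0 from rfl, LinearMap.range_zero]
    infer_instance
  smul_mem' := by
    intro c a ha
    have h : LinearMap.range ((c • a : X →L[ℂ] X) : X →ₗ[ℂ] X) ≤
        LinearMap.range ((a : X →L[ℂ] X) : X →ₗ[ℂ] X) := by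
      rintro x ⟨y, rfl⟩
      exact ⟨c • y, by simp⟩
    haveI : FiniteDimensional ℂ (LinearMap.range ((a : X →L[ℂ] X) : X →ₗ[ℂ] X)) := ha
    exact Submodule.finiteDimensional_of_le h

namespace MultilinearMap

variable {n : ℕ} {M Y : Type*} [AddCommGroup M] [Module ℂ M]
  [NormedAddCommGroup Y] [NormedSpace ℂ Y]

/-- The derivative at `a` of the homogeneous polynomial `b ↦ φ (b, …, b)`, as a linear map. -/
def diagDeriv (φ : MultilinearMap ℂ (fun _ : Fin n => M) Y) (a : M) : M →ₗ[ℂ] Y :=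
  φ.linearDeriv (fun _ => a) ∘ₗ LinearMap.pi (fun _ => LinearMap.id)

theorem diagDeriv_apply (φ : MultilinearMap ℂ (fun _ : Fin n => M) Y) (a b : M) :
    φ.diagDeriv a b = ∑ i, φ (Function.update (fun _ => a) i b) := by
  simp [diagDeriv]

theorem diagDeriv_self (φ : MultilinearMap ℂ (fun _ : Fin n => M) Y) (a : M) :
    φ.diagDeriv a a = (n : ℂ) • φ (fun _ => a) := by
  simp [diagDeriv_apply, Nat.cast_smul_eq_nsmul]

theorem diagDeriv_compLinearMap {N : Type*} [AddCommGroup N] [Module ℂ N]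
    (φ : MultilinearMap ℂ (fun _ : Fin n => M) Y) (f : N →ₗ[ℂ] M) (a b : N) :
    (φ.compLinearMap fun _ => f).diagDeriv a b = φ.diagDeriv (f a) (f b) := by
  simp only [diagDeriv_apply, compLinearMap_apply]
  refine Finset.sum_congr rfl fun i _ => congrArg φ ?_
  ext j
  by_cases h : j = i <;> simp [h]

theorem hasDerivAt_diag_zero (φ : MultilinearMap ℂ (fun _ : Fin n => M) Y) (a b : M) :
    HasDerivAt (fun t : ℂ => φ (fun _ => a + t • b)) (φ.diagDeriv a b) 0 := by
  have key : ∀ t : ℂ, φ (fun _ => a + t • b) = φ (fun _ => a) + t • φ.diagDeriv a b +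
      ∑ s : Finset (Fin n) with 2 ≤ s.card,
        t ^ s.card • φ (s.piecewise (fun _ => b) fun _ => a) := by
    intro t
    have h := φ.map_add_eq_map_add_linearDeriv_add (fun _ => a) (fun _ => t • b)
    rw [show ((fun _ => a) + fun _ => t • b : Fin n → M) = fun _ => a + t • b from rfl] at h
    rw [h]
    congr 1
    · rw [← map_smul]; rfl
    · refine Finset.sum_congr rfl fun s _ => ?_
      rw [← Finset.prod_const, ← φ.map_piecewise_smul]
      congr 1
      ext j
      by_cases hj : j ∈ s <;> simp [hj]
  simp_rw [key]
  have h1 : HasDerivAt (fun t : ℂ => t • φ.diagDeriv a b) (φ.diagDeriv a b) 0 := by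
    simpa using (hasDerivAt_id (0 : ℂ)).smul_const (φ.diagDeriv a b)
  have h2 : HasDerivAt (fun t : ℂ => ∑ s : Finset (Fin n) with 2 ≤ s.card,
      t ^ s.card • φ (s.piecewise (fun _ => b) fun _ => a))
      (∑ s : Finset (Fin n) with 2 ≤ s.card, (0 : Y)) 0 := by
    refine HasDerivAt.fun_sum fun s hs => ?_
    have hs' : 2 ≤ s.card := (Finset.mem_filter.1 hs).2
    have h := (hasDerivAt_pow s.card (0 : ℂ)).smul_const (φ (s.piecewise (fun _ => b) fun _ => a))
    rwa [zero_pow (by omega), mul_zero, zero_smul] at h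
  simpa using! (h1.const_add (φ fun _ => a)).add h2

theorem differentiable_diag (φ : MultilinearMap ℂ (fun _ : Fin n => M) Y) (a b : M) :
    Differentiable ℂ (fun t : ℂ => φ (fun _ => a + t • b)) := by
  intro t₀
  have h := φ.hasDerivAt_diag_zero (a + t₀ • b) b
  rw [← sub_self t₀] at h
  have h' := h.comp_sub_const t₀ t₀
  refine h'.differentiableAt.congr_of_eventuallyEq (.of_forall fun t => ?_)
  simp only [sub_smul, add_assoc, add_sub_cancel]

/-- A homogeneous polynomial on a complex star module that vanishes on the self-adjoint elements
is zero. -/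
theorem diag_eq_zero_of_isSelfAdjoint [StarAddMonoid M] [StarModule ℂ M] [CompleteSpace Y]
    (φ : MultilinearMap ℂ (fun _ : Fin n => M) Y)
    (h : ∀ a, IsSelfAdjoint a → φ (fun _ => a) = 0) (a : M) : φ (fun _ => a) = 0 := by
  have han := (φ.differentiable_diag (realPart a : M) (imaginaryPart a : M)).differentiableOn
    |>.analyticOnNhd isOpen_univ
  have h0 := han.eq_of_frequently_eq (g := fun _ => 0) (z₀ := 0) analyticOnNhd_const ?_
  · have := congrFun h0 Complex.I
    rwa [realPart_add_I_smul_imaginaryPart] at this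
  · have : Filter.Tendsto (fun t : ℝ => (t : ℂ)) (nhdsWithin 0 {0}ᶜ) (nhdsWithin 0 {0}ᶜ) := by
      refine tendsto_nhdsWithin_iff.2 ⟨?_, ?_⟩
      · exact (Complex.continuous_ofReal.tendsto' 0 0 (by simp)).mono_left nhdsWithin_le_nhds
      · filter_upwards [self_mem_nhdsWithin] with t ht
        simpa using ht
    refine this.frequently (Filter.Eventually.frequently (.of_forall fun t => h _ ?_))
    refine (realPart a).2.add ?_
    rw [Complex.coe_smul]
    exact (IsSelfAdjoint.all t).smul (imaginaryPart a).2

/-- Derivatives of an orthogonally additive polynomial do not see an orthogonal summand. -/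
theorem diagDeriv_add_left (φ : MultilinearMap ℂ (fun _ : Fin n => M) Y) {a b c : M}
    (h : ∀ t : ℂ, φ (fun _ => (a + t • b) + c) = φ (fun _ => a + t • b) + φ (fun _ => c)) :
    φ.diagDeriv (a + c) b = φ.diagDeriv a b := by
  refine (φ.hasDerivAt_diag_zero (a + c) b).unique ?_
  refine ((φ.hasDerivAt_diag_zero a b).add_const (φ fun _ => c)).congr_of_eventuallyEq
    (.of_forall fun t => ?_)
  simp only [← h, add_right_comm]

end MultilinearMap

section OrthogonalIdempotents

variable {ι A : Type*} [DecidableEq ι] [Ring A] [Algebra ℂ A]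

theorem sum_smul_pow_of_orthogonalIdempotents [Fintype ι] {p : ι → A}
    (hp : OrthogonalIdempotents p) (c : ι → ℂ) {n : ℕ} (hn : 0 < n) :
    (∑ i, c i • p i) ^ n = ∑ i, c i ^ n • p i := by
  induction n, hn using Nat.le_induction with
  | base => simp
  | succ m _ ih =>
    rw [pow_succ, ih, Finset.sum_mul_sum]
    refine Finset.sum_congr rfl fun i _ => ?_
    simp [hp.mul_eq, pow_succ', mul_smul]

variable {Y : Type*} [NormedAddCommGroup Y] [NormedSpace ℂ Y] {n : ℕ}

theorem MultilinearMap.diag_sum_smul_of_orthogonalIdempotents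
    (φ : MultilinearMap ℂ (fun _ : Fin n => A) Y) (hn : 0 < n)
    (horth : ∀ S T : A, S * T = 0 → T * S = 0 →
      φ (fun _ => S + T) = φ (fun _ => S) + φ (fun _ => T))
    {p : ι → A} (hp : OrthogonalIdempotents p) (c : ι → ℂ) (s : Finset ι) :
    φ (fun _ => ∑ i ∈ s, c i • p i) = ∑ i ∈ s, c i ^ n • φ (fun _ => p i) := by
  induction s using Finset.induction_on with
  | empty =>
    have : Nonempty (Fin n) := ⟨⟨0, hn⟩⟩
    exact φ.map_zero
  | insert i s hi ih =>
    have hne : ∀ j ∈ s, i ≠ j := fun j hj h => hi (h ▸ hj)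
    simp only [Finset.sum_insert hi]
    rw [horth, ih]
    · congr 1
      simpa using φ.map_smul_univ (fun _ => c i) (fun _ => p i)
    · rw [Finset.mul_sum]
      refine Finset.sum_eq_zero fun j hj => ?_
      rw [smul_mul_smul_comm, hp.ortho (hne j hj), smul_zero]
    · rw [Finset.sum_mul]
      refine Finset.sum_eq_zero fun j hj => ?_
      rw [smul_mul_smul_comm, hp.ortho (hne j hj).symm, smul_zero]

end OrthogonalIdempotents

theorem Matrix.IsHermitian.exists_orthogonalIdempotents {k : Type*} [Fintype k] [DecidableEq k]
    {H : Matrix k k ℂ} (hH : H.IsHermitian) :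
    ∃ (c : k → ℂ) (p : k → Matrix k k ℂ), OrthogonalIdempotents p ∧ H = ∑ i, c i • p i := by
  let F := Unitary.conjStarAlgAut ℂ _ hH.eigenvectorUnitary
  refine ⟨fun i => hH.eigenvalues i, fun i => F (Matrix.single i i 1), ?_, ?_⟩
  · refine ⟨fun i => ?_, fun i j hij => ?_⟩
    · rw [IsIdempotentElem, ← map_mul]; simp
    · change F _ * F _ = 0
      rw [← map_mul, Matrix.single_mul_single_of_ne _ _ _ _ hij, map_zero]
  · conv_lhs => rw [hH.spectral_theorem]
    simp_rw [← map_smul, ← map_sum]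
    congr 1
    ext a b
    simp [Matrix.sum_apply, Matrix.single_apply, Matrix.diagonal_apply, ite_and]

section Matrix

variable {k Y : Type*} [Fintype k] [DecidableEq k] [NormedAddCommGroup Y] [NormedSpace ℂ Y]

theorem Matrix.linearMap_eq_zero_of_isIdempotentElem (L : Matrix k k ℂ →ₗ[ℂ] Y)
    (h : ∀ p, IsIdempotentElem p → L p = 0) : L = 0 := by
  have hs : ∀ H : Matrix k k ℂ, IsSelfAdjoint H → L H = 0 := by
    intro H hH
    obtain ⟨c, p, hp, rfl⟩ := Matrix.IsHermitian.exists_orthogonalIdempotents hH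
    simp [h _ (hp.idem _)]
  ext1 M
  rw [← realPart_add_I_smul_imaginaryPart M, map_add, map_smul, hs _ (realPart M).2,
    hs _ (imaginaryPart M).2]
  simp

theorem Matrix.diag_eq_diagDeriv_one_pow [CompleteSpace Y] {n : ℕ} (hn : 0 < n)
    (φ : MultilinearMap ℂ (fun _ : Fin n => Matrix k k ℂ) Y)
    (horth : ∀ S T : Matrix k k ℂ, S * T = 0 → T * S = 0 →
      φ (fun _ => S + T) = φ (fun _ => S) + φ (fun _ => T)) (M : Matrix k k ℂ) :
    (n : ℂ) • φ (fun _ => M) = φ.diagDeriv 1 (M ^ n) := by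
  have hidem : ∀ p : Matrix k k ℂ, IsIdempotentElem p →
      φ.diagDeriv 1 p = (n : ℂ) • φ (fun _ => p) := by
    intro p hp
    have h := φ.diagDeriv_add_left (a := p) (b := p) (c := 1 - p) fun t => horth _ _
      (by simp [add_mul, mul_sub, hp.eq]) (by simp [mul_add, sub_mul, hp.eq])
    rwa [add_sub_cancel, φ.diagDeriv_self] at h
  have h := MultilinearMap.diag_eq_zero_of_isSelfAdjoint
    ((n : ℂ) • φ - (φ.diagDeriv 1).compMultilinearMap
      (MultilinearMap.mkPiAlgebraFin ℂ n (Matrix k k ℂ))) ?_ M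
  · simpa [sub_eq_zero] using h
  · intro H hH
    obtain ⟨c, p, hp, rfl⟩ := Matrix.IsHermitian.exists_orthogonalIdempotents hH
    simp [φ.diag_sum_smul_of_orthogonalIdempotents hn horth hp,
      sum_smul_pow_of_orthogonalIdempotents hp c hn, hidem _ (hp.idem _), Finset.smul_sum,
      smul_comm (n : ℂ)]

end Matrix

section FiniteRank

variable {X : Type*} [NormedAddCommGroup X] [NormedSpace ℂ X]

open ContinuousLinearMap

theorem FinRankOps.mul_right_mem {S : X →L[ℂ] X} (hS : S ∈ FinRankOps X) (T : X →L[ℂ] X) :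
    S * T ∈ FinRankOps X := by
  have : FiniteDimensional ℂ (LinearMap.range (S : X →ₗ[ℂ] X)) := hS
  exact Submodule.finiteDimensional_of_le (LinearMap.range_comp_le_range (T : X →ₗ[ℂ] X) _)

theorem FinRankOps.exists_mul_eq_self {T : X →L[ℂ] X} (hT : T ∈ FinRankOps X) :
    ∃ q ∈ FinRankOps X, T * q = T := by
  have : FiniteDimensional ℂ (LinearMap.range (T : X →ₗ[ℂ] X)) := hT
  let T' : X →L[ℂ] LinearMap.range (T : X →ₗ[ℂ] X) := T.codRestrict _ fun x => ⟨x, rfl⟩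
  obtain ⟨g, hg⟩ := (T : X →ₗ[ℂ] X).rangeRestrict.exists_rightInverse_of_surjective
    (LinearMap.range_rangeRestrict _)
  refine ⟨LinearMap.toContinuousLinearMap g ∘L T', ?_, ?_⟩
  · exact Submodule.finiteDimensional_of_le (S₂ := LinearMap.range g)
      (LinearMap.range_comp_le_range (T' : X →ₗ[ℂ] _) g)
  · ext x
    exact congrArg Subtype.val (DFunLike.congr_fun hg (T' x))

theorem FinRankOps.exists_isIdempotentElem_fixing (V : Submodule ℂ X) [FiniteDimensional ℂ V] :
    ∃ p ∈ FinRankOps X, IsIdempotentElem p ∧ ∀ x ∈ V, p x = x := by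
  obtain ⟨f, hf⟩ := Submodule.ClosedComplemented.of_finiteDimensional V
  have hV : ∀ x ∈ V, (f x : X) = x := fun x hx => congrArg Subtype.val (hf ⟨x, hx⟩)
  refine ⟨V.subtypeL ∘L f, ?_, ?_, hV⟩
  · refine Submodule.finiteDimensional_of_le (S₂ := V) ?_
    rintro _ ⟨x, rfl⟩
    exact (f x).2
  · ext x
    exact hV _ (f x).2

/-- `e` is a finite-rank idempotent acting as a two-sided unit on `T`. -/
structure FinRankOps.IsLocalUnit (e T : FinRankOps X) : Prop where
  idem : IsIdempotentElem (e : X →L[ℂ] X)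
  left : (e : X →L[ℂ] X) * T = T
  right : (T : X →L[ℂ] X) * e = T

theorem FinRankOps.exists_isLocalUnit (S T : FinRankOps X) :
    ∃ e : FinRankOps X, IsLocalUnit e S ∧ IsLocalUnit e T := by
  obtain ⟨q₁, hq₁, h₁⟩ := exists_mul_eq_self S.2
  obtain ⟨q₂, hq₂, h₂⟩ := exists_mul_eq_self (T := (T : X →L[ℂ] X) - (T : X →L[ℂ] X) * q₁)
    (sub_mem T.2 (mul_right_mem T.2 _))
  let q := q₁ + q₂ - q₁ * q₂
  have hq : q ∈ FinRankOps X := sub_mem (add_mem hq₁ hq₂) (mul_right_mem hq₁ _)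
  have hSq : (S : X →L[ℂ] X) * q = S := by
    simp only [q, mul_sub, mul_add, ← mul_assoc, h₁]; abel
  have hTq : (T : X →L[ℂ] X) * q = T := by
    rw [sub_mul] at h₂
    simp only [q, mul_sub, mul_add, ← mul_assoc]
    rw [add_sub_assoc, h₂]; abel
  have : FiniteDimensional ℂ (LinearMap.range ((S : X →L[ℂ] X) : X →ₗ[ℂ] X)) := S.2
  have : FiniteDimensional ℂ (LinearMap.range ((T : X →L[ℂ] X) : X →ₗ[ℂ] X)) := T.2
  have : FiniteDimensional ℂ (LinearMap.range (q : X →ₗ[ℂ] X)) := hq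
  obtain ⟨p, hp, hpp, hfix⟩ := exists_isIdempotentElem_fixing
    (LinearMap.range ((S : X →L[ℂ] X) : X →ₗ[ℂ] X) ⊔
      LinearMap.range ((T : X →L[ℂ] X) : X →ₗ[ℂ] X) ⊔ LinearMap.range (q : X →ₗ[ℂ] X))
  have hpS : p * S = S := by
    ext x
    exact hfix _ (Submodule.mem_sup_left (Submodule.mem_sup_left ⟨x, rfl⟩))
  have hpT : p * T = T := by
    ext x
    exact hfix _ (Submodule.mem_sup_left (Submodule.mem_sup_right ⟨x, rfl⟩))
  have hpq : p * q = q := by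
    ext x
    exact hfix _ (Submodule.mem_sup_right ⟨x, rfl⟩)
  have hidem : IsIdempotentElem (p + q - q * p) := by
    have h : p * (p + q - q * p) = p + q - q * p := by
      rw [mul_sub, mul_add, hpp.eq, hpq, ← mul_assoc, hpq]
    rw [IsIdempotentElem, sub_mul, add_mul, mul_assoc q, h]
    abel
  refine ⟨⟨p + q - q * p, sub_mem (add_mem hp hq) (mul_right_mem hq _)⟩,
    ⟨hidem, ?_, ?_⟩, ⟨hidem, ?_, ?_⟩⟩
  · simp only [sub_mul, add_mul, mul_assoc, hpS]; abel
  · simp only [mul_sub, mul_add, ← mul_assoc, hSq]; abel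
  · simp only [sub_mul, add_mul, mul_assoc, hpT]; abel
  · simp only [mul_sub, mul_add, ← mul_assoc, hTq]; abel

/-- The corner of a finite-rank idempotent is a full matrix algebra. -/
theorem FinRankOps.exists_matrix_corner (e : FinRankOps X)
    (he : IsIdempotentElem (e : X →L[ℂ] X)) :
    ∃ (k : ℕ) (ι : Matrix (Fin k) (Fin k) ℂ →ₗ[ℂ] FinRankOps X),
      (∀ M N, (ι (M * N) : X →L[ℂ] X) = ι M * ι N) ∧ ι 1 = e ∧
        ∀ T, IsLocalUnit e T → ∃ M, ι M = T := by
  let V := LinearMap.range ((e : X →L[ℂ] X) : X →ₗ[ℂ] X)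
  have : FiniteDimensional ℂ V := e.2
  let p : X →L[ℂ] V := (e : X →L[ℂ] X).codRestrict V fun x => ⟨x, rfl⟩
  have hp : ∀ v : V, p v = v := by
    rintro ⟨_, x, rfl⟩
    exact Subtype.ext (DFunLike.congr_fun he.eq x)
  let b := Module.finBasis ℂ V
  let F : Matrix _ _ ℂ →ₗ[ℂ] X →L[ℂ] X :=
    { toFun := fun M => V.subtypeL ∘L LinearMap.toContinuousLinearMap (Matrix.toLin b b M) ∘L p
      map_add' := fun M N => by ext x; simp
      map_smul' := fun c M => by ext x; simp }
  have hF : ∀ M x, F M x = Matrix.toLin b b M (p x) := fun M x => rfl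
  refine ⟨_, F.codRestrict _ fun M => ?_, fun M N => ?_, ?_, fun T hT => ?_⟩
  · refine Submodule.finiteDimensional_of_le (S₂ := V) ?_
    rintro _ ⟨x, rfl⟩
    exact (Matrix.toLin b b M (p x)).2
  · ext x
    change F (M * N) x = F M (F N x)
    simp [hF, Matrix.toLin_mul b b b, hp]
  · ext x
    change F 1 x = e.1 x
    rw [hF, Matrix.toLin_one]
    rfl
  · refine ⟨LinearMap.toMatrix b b
      ((p : X →ₗ[ℂ] V) ∘ₗ ((T : X →L[ℂ] X) : X →ₗ[ℂ] X) ∘ₗ V.subtype), ?_⟩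
    ext x
    change F _ x = T.1 x
    rw [hF, Matrix.toLin_toMatrix]
    change (e : X →L[ℂ] X) ((T : X →L[ℂ] X) ((e : X →L[ℂ] X) x)) = _
    have h : (e : X →L[ℂ] X) * ((T : X →L[ℂ] X) * e) = T := by rw [hT.right, hT.left]
    exact DFunLike.congr_fun h x

theorem FinRankOps.diagDeriv_eq_of_isLocalUnit {Y : Type*} [NormedAddCommGroup Y]
    [NormedSpace ℂ Y] {n : ℕ} (φ : MultilinearMap ℂ (fun _ : Fin n => FinRankOps X) Y)
    (horth : ∀ S T : FinRankOps X,
      (S : X →L[ℂ] X) * (T : X →L[ℂ] X) = 0 → (T : X →L[ℂ] X) * (S : X →L[ℂ] X) = 0 →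
      φ (fun _ => S + T) = φ (fun _ => S) + φ (fun _ => T))
    {e f T : FinRankOps X} (he : IsLocalUnit e T) (hf : IsLocalUnit f T) :
    φ.diagDeriv e T = φ.diagDeriv f T := by
  obtain ⟨g, hge, hgf⟩ := exists_isLocalUnit e f
  have key : ∀ d : FinRankOps X, IsLocalUnit d T → IsLocalUnit g d →
      φ.diagDeriv g T = φ.diagDeriv d T := by
    intro d hd hgd
    have hgT : (g : X →L[ℂ] X) * T = T := by
      rw [← hd.left, ← mul_assoc, hgd.left]
    have hTg : (T : X →L[ℂ] X) * g = T := by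
      rw [← hd.right, mul_assoc, hgd.right]
    have h := φ.diagDeriv_add_left (a := d) (b := T) (c := g - d) fun t => horth _ _
      (by simp [add_mul, mul_sub, hd.idem.eq, hgd.right, hd.right, hTg])
      (by simp [mul_add, sub_mul, hd.idem.eq, hgd.left, hd.left, hgT])
    rwa [add_sub_cancel] at h
  rw [← key e he hge, key f hf hgf]

end FiniteRank

/-- an orthogonally additive `n`-homogeneous polynomial on the
algebra `𝓕(X)` of finite-rank operators has a unique linear representation
`P T = Φ (Tⁿ)` (no continuity assumed or asserted). -/
theorem stmt8 {X Y : Type*} [NormedAddCommGroup X] [NormedSpace ℂ X] [CompleteSpace X]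
    [NormedAddCommGroup Y] [NormedSpace ℂ Y] [CompleteSpace Y]
    (n : ℕ) (hn : 0 < n)
    (φ : MultilinearMap ℂ (fun _ : Fin n => ↥(FinRankOps X)) Y)
    (P : ↥(FinRankOps X) → Y) (hP : ∀ T, P T = φ (fun _ => T))
    (horth : ∀ S T : ↥(FinRankOps X),
      (S : X →L[ℂ] X) * (T : X →L[ℂ] X) = 0 → (T : X →L[ℂ] X) * (S : X →L[ℂ] X) = 0 →
      P (S + T) = P S + P T) :
    ∃! Φ : ↥(FinRankOps X) →ₗ[ℂ] Y,
      ∀ T Tn : ↥(FinRankOps X), (Tn : X →L[ℂ] X) = (T : X →L[ℂ] X) ^ n → P T = Φ Tn := by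
  have horth' : ∀ S T : FinRankOps X,
      (S : X →L[ℂ] X) * (T : X →L[ℂ] X) = 0 → (T : X →L[ℂ] X) * (S : X →L[ℂ] X) = 0 →
      φ (fun _ => S + T) = φ (fun _ => S) + φ (fun _ => T) := by
    simpa only [hP] using horth
  have hn' : (n : ℂ) ≠ 0 := Nat.cast_ne_zero.2 hn.ne'
  choose u hu using fun T : FinRankOps X => (FinRankOps.exists_isLocalUnit T T).imp fun _ h => h.1
  have hD : ∀ {e T}, FinRankOps.IsLocalUnit e T → φ.diagDeriv (u T) T = φ.diagDeriv e T :=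
    fun he => FinRankOps.diagDeriv_eq_of_isLocalUnit φ horth' (hu _) he
  let Φ : FinRankOps X →ₗ[ℂ] Y :=
    { toFun := fun T => (n : ℂ)⁻¹ • φ.diagDeriv (u T) T
      map_add' := fun S T => by
        obtain ⟨e, heS, heT⟩ := FinRankOps.exists_isLocalUnit S T
        have heST : FinRankOps.IsLocalUnit e (S + T) :=
          ⟨heS.idem, by simp [mul_add, heS.left, heT.left],
            by simp [add_mul, heS.right, heT.right]⟩
        rw [hD heST, hD heS, hD heT, map_add, smul_add]
      map_smul' := fun c T => by
        have h : FinRankOps.IsLocalUnit (u T) (c • T) :=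
          ⟨(hu T).idem, by simp [(hu T).left], by simp [(hu T).right]⟩
        rw [hD h, map_smul, smul_comm, RingHom.id_apply] }
  refine existsUnique_of_exists_of_unique ⟨Φ, fun T Tn hTn => ?_⟩ fun Φ₁ Φ₂ h₁ h₂ => ?_
  · obtain ⟨k, ι, hmul, hone, hsurj⟩ := FinRankOps.exists_matrix_corner (u T) (hu T).idem
    obtain ⟨M, rfl⟩ := hsurj T (hu T)
    have hpow : ∀ m, 0 < m → (ι (M ^ m) : X →L[ℂ] X) = (ι M : X →L[ℂ] X) ^ m := by
      intro m hm
      induction m, hm using Nat.le_induction with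
      | base => simp
      | succ m _ ih => rw [pow_succ, hmul, ih, pow_succ]
    obtain rfl : ι (M ^ n) = Tn := Subtype.ext ((hpow n hn).trans hTn.symm)
    have hunit : FinRankOps.IsLocalUnit (u (ι M)) (ι (M ^ n)) :=
      ⟨(hu _).idem, by rw [← hone, ← hmul, one_mul], by rw [← hone, ← hmul, mul_one]⟩
    have h := Matrix.diag_eq_diagDeriv_one_pow hn (φ.compLinearMap fun _ => ι)
      (fun A B hAB hBA => by
        simpa using horth' (ι A) (ι B) (by simp [← hmul, hAB]) (by simp [← hmul, hBA])) M
    rw [φ.diagDeriv_compLinearMap, hone] at h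
    change P (ι M) = (n : ℂ)⁻¹ • φ.diagDeriv (u (ι (M ^ n))) (ι (M ^ n))
    rw [hD hunit, ← h, inv_smul_smul₀ hn', hP]
    rfl
  · ext1 T
    obtain ⟨k, ι, hmul, -, hsurj⟩ := FinRankOps.exists_matrix_corner (u T) (hu T).idem
    obtain ⟨M, rfl⟩ := hsurj T (hu T)
    have h := Matrix.linearMap_eq_zero_of_isIdempotentElem ((Φ₁ - Φ₂) ∘ₗ ι) fun p hp => by
      have hidem : IsIdempotentElem (ι p : X →L[ℂ] X) := by
        rw [IsIdempotentElem, ← hmul, hp.eq]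
      have hpow := (hidem.pow_eq hn.ne').symm
      simp [← h₁ _ _ hpow, ← h₂ _ _ hpow]
    simpa [sub_eq_zero] using DFunLike.congr_fun h M
end

section
/- Let X and Y be complex Banach spaces such that X* has the bounded approximation property, and let P : 𝓐(X) → Y be a continuous n-homogeneous polynomial on the algebra 𝓐(X) of approximable operators. If P is orthogonally additive, then there exists a unique continuous linear map Φ : 𝓐(X) → Y such that P(T) = Φ(Tⁿ) for every T ∈ 𝓐(X). -/
open Filter Topology

/-- The algebra `𝓐(X)` of approximable operators on `X`: the operator-norm
closure of the finite-rank operators. -/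
noncomputable def ApproxOps (X : Type*) [NormedAddCommGroup X] [NormedSpace ℂ X] :
    Submodule ℂ (X →L[ℂ] X) := (FinRankOps X).topologicalClosure

/-- `X*` has the bounded approximation property. -/
def DualHasBAP (X : Type*) [NormedAddCommGroup X] [NormedSpace ℂ X] : Prop :=
  ∃ C : ℝ, 0 < C ∧ ∀ (F : Finset (X →L[ℂ] ℂ)) (ε : ℝ), 0 < ε →
    ∃ S : (X →L[ℂ] ℂ) →L[ℂ] (X →L[ℂ] ℂ),
      FiniteDimensional ℂ (LinearMap.range (S : (X →L[ℂ] ℂ) →ₗ[ℂ] (X →L[ℂ] ℂ))) ∧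
      ‖S‖ ≤ C ∧ ∀ f ∈ F, ‖S f - f‖ < ε

open Polynomial in
/-- An element of a complex algebra annihilated by a split polynomial with simple roots is a
linear combination of orthogonal idempotents. -/
theorem exists_orthogonal_idempotents_of_aeval_eq_zero {R : Type*} [Ring R] [Algebra ℂ R]
    (s : Finset ℂ) (B : R) (hB : aeval B (∏ z ∈ s, (X - C z)) = 0) :
    ∃ e : ℂ → R, (∀ z ∈ s, e z * e z = e z) ∧ (∀ z ∈ s, ∀ w ∈ s, z ≠ w → e z * e w = 0) ∧
      B = ∑ z ∈ s, z • e z := by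
  have key : ∀ f g : ℂ[X], (∀ z ∈ s, f.eval z = g.eval z) → aeval B f = aeval B g := by
    intro f g hfg
    have hdvd : (∏ z ∈ s, (X - C z)) ∣ f - g := by
      refine Finset.prod_dvd_of_coprime ?_ ?_
      · intro z _ w _ hzw
        exact pairwise_coprime_X_sub_C (Function.injective_id) hzw
      · intro z hz
        rw [dvd_iff_isRoot]
        simp [hfg z hz]
    obtain ⟨q, hq⟩ := hdvd
    have : aeval B (f - g) = 0 := by rw [hq, map_mul, hB, zero_mul]
    rwa [map_sub, sub_eq_zero] at this
  have heval : ∀ z ∈ s, ∀ w ∈ s, (Lagrange.basis s id z).eval w = if z = w then 1 else 0 := by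
    intro z hz w hw
    split_ifs with h
    · subst h
      exact Lagrange.eval_basis_self (v := id) Function.injective_id.injOn hz
    · exact Lagrange.eval_basis_of_ne (v := id) h hw
  refine ⟨fun z => aeval B (Lagrange.basis s id z), ?_, ?_, ?_⟩
  · intro z hz
    rw [← map_mul]
    refine key _ _ fun w hw => ?_
    rw [eval_mul, heval z hz w hw]
    split_ifs <;> simp
  · intro z hz w hw hzw
    rw [← map_mul, ← map_zero (aeval (R := ℂ) B)]
    refine key _ _ fun u hu => ?_
    rw [eval_mul, heval z hz u hu, heval w hw u hu, eval_zero]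
    split_ifs with h1 h2
    · exact absurd (h1.trans h2.symm) hzw
    all_goals simp
  · have : aeval B (X : ℂ[X]) = aeval B (∑ z ∈ s, z • Lagrange.basis s id z) := by
      refine key _ _ fun w hw => ?_
      simp only [eval_X, eval_finsetSum, eval_smul, smul_eq_mul]
      rw [Finset.sum_eq_single w]
      · simp [heval w hw w hw]
      · intro z hz hzw
        simp [heval z hz w hw, hzw]
      · exact fun h => absurd hw h
    simpa using this

open Polynomial in
/-- Matrices with simple spectrum are dense. -/
theorem mem_closure_separable_charpoly {k : ℕ} (A : Matrix (Fin k) (Fin k) ℂ) :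
    A ∈ closure {B : Matrix (Fin k) (Fin k) ℂ | B.charpoly.Separable} := by
  set D : Matrix (Fin k) (Fin k) ℂ := Matrix.diagonal fun i => ((i : ℕ) : ℂ)
  set M : Matrix (Fin k) (Fin k) ℂ[X] := (1 - X : ℂ[X]) • A.map C + (X : ℂ[X]) • D.map C
  have hM : ∀ t : ℂ, M.map (evalRingHom t) = (1 - t) • A + t • D := by
    intro t
    ext i j
    simp [M]
    ring
  set r : ℂ[X] := M.charpoly.resultant (derivative M.charpoly)
  have hr : ∀ t : ℂ, r.eval t ≠ 0 ↔ ((1 - t) • A + t • D).charpoly.Separable := by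
    intro t
    have hc : ((1 - t) • A + t • D).charpoly = M.charpoly.map (evalRingHom t) := by
      rw [← hM, Matrix.charpoly_map]
    have h1 : ((1 - t) • A + t • D).charpoly.resultant
        (derivative ((1 - t) • A + t • D).charpoly) = r.eval t := by
      rw [natDegree_derivative, Matrix.charpoly_natDegree_eq_dim, hc, derivative_map,
        resultant_map_map]
      simp [r, natDegree_derivative, Matrix.charpoly_natDegree_eq_dim]
    rw [← h1, ← isUnit_iff_ne_zero, isUnit_resultant_iff_isCoprime (Matrix.charpoly_monic _)]
    rfl
  have hr1 : r.eval 1 ≠ 0 := by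
    rw [hr]
    simp only [sub_self, zero_smul, one_smul, zero_add, D]
    rw [Matrix.charpoly_diagonal, separable_prod_X_sub_C_iff]
    intro i j hij
    exact Fin.ext (by simpa using hij)
  have hr0 : r ≠ 0 := by
    rintro h
    simp [h] at hr1
  have hdense : Dense {t : ℂ | r.eval t ≠ 0} := by
    have hfin : {t : ℂ | r.eval t = 0}.Finite := by
      refine (r.roots.toFinset.finite_toSet).subset fun t ht => ?_
      simpa [hr0] using ht
    exact hfin.countable.dense_compl ℂ
  have hcont : Continuous fun t : ℂ => (1 - t) • A + t • D := by fun_prop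
  have := map_mem_closure hcont (hdense 0) (t := {B | B.charpoly.Separable})
    fun t ht => by simpa using (hr t).1 (by simpa using ht)
  simpa using this

open Polynomial in
theorem Matrix.aeval_prod_roots_toFinset_of_separable {k : ℕ} {B : Matrix (Fin k) (Fin k) ℂ}
    (hB : B.charpoly.Separable) :
    aeval B (∏ z ∈ B.charpoly.roots.toFinset, (X - C z)) = 0 := by
  rw [Finset.prod, Multiset.toFinset_val, (nodup_roots hB).dedup,
    ← (IsAlgClosed.splits _).eq_prod_roots_of_monic (Matrix.charpoly_monic B),
    Matrix.aeval_self_charpoly]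

section FiniteRank

variable {X : Type*} [NormedAddCommGroup X] [NormedSpace ℂ X]

theorem mem_finRankOps_comp {V : Type*} [NormedAddCommGroup V] [NormedSpace ℂ V]
    [FiniteDimensional ℂ V] (R : V →L[ℂ] X) (J : X →L[ℂ] V) : R ∘L J ∈ FinRankOps X := by
  have h : LinearMap.range ((R ∘L J : X →L[ℂ] X) : X →ₗ[ℂ] X) ≤
      LinearMap.range (R : V →ₗ[ℂ] X) := by
    rintro x ⟨y, rfl⟩
    exact ⟨J y, rfl⟩
  exact Submodule.finiteDimensional_of_le h

theorem mul_mem_finRankOps_left {T : X →L[ℂ] X} (hT : T ∈ FinRankOps X) (S : X →L[ℂ] X) :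
    T * S ∈ FinRankOps X := by
  have h : LinearMap.range ((T * S : X →L[ℂ] X) : X →ₗ[ℂ] X) ≤
      LinearMap.range (T : X →ₗ[ℂ] X) := by
    rintro x ⟨y, rfl⟩
    exact ⟨S y, rfl⟩
  have : FiniteDimensional ℂ (LinearMap.range (T : X →ₗ[ℂ] X)) := hT
  exact Submodule.finiteDimensional_of_le h

theorem mul_mem_finRankOps_right {T : X →L[ℂ] X} (hT : T ∈ FinRankOps X) (S : X →L[ℂ] X) :
    S * T ∈ FinRankOps X := by
  have : FiniteDimensional ℂ (LinearMap.range (T : X →ₗ[ℂ] X)) := hT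
  exact mem_finRankOps_comp (S ∘L (LinearMap.range (T : X →ₗ[ℂ] X)).subtypeL)
    (T.codRestrict _ fun x => ⟨x, rfl⟩)

theorem exists_finRank_mul_right_eq (s : Finset (X →L[ℂ] X)) (hs : ∀ T ∈ s, T ∈ FinRankOps X) :
    ∃ P ∈ FinRankOps X, ∀ T ∈ s, T * P = T := by
  have hfin : ∀ T : s, FiniteDimensional ℂ (LinearMap.range (T.1 : X →ₗ[ℂ] X)) :=
    fun T => hs T T.2
  let A : X →L[ℂ] (∀ T : s, LinearMap.range (T.1 : X →ₗ[ℂ] X)) :=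
    ContinuousLinearMap.pi fun T => T.1.codRestrict _ fun x => ⟨x, rfl⟩
  let A' : X →L[ℂ] LinearMap.range A.toLinearMap := A.codRestrict _ fun x => ⟨x, rfl⟩
  have hsurj : LinearMap.range A'.toLinearMap = ⊤ := by
    rw [LinearMap.range_eq_top]
    rintro ⟨_, x, rfl⟩
    exact ⟨x, rfl⟩
  obtain ⟨r, hr⟩ := LinearMap.exists_rightInverse_of_surjective _ hsurj
  have hr' : ∀ y, A' (r y) = y := fun y => LinearMap.congr_fun hr y
  refine ⟨r.toContinuousLinearMap ∘L A', mem_finRankOps_comp _ _, fun T hT => ?_⟩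
  ext x
  have h2 : A (r (A' x)) = A x := congrArg Subtype.val (hr' _)
  exact congrArg Subtype.val (congrFun h2 ⟨T, hT⟩)

theorem exists_finRank_mul_left_eq (M : Submodule ℂ X) [FiniteDimensional ℂ M] :
    ∃ P ∈ FinRankOps X, P * P = P ∧ ∀ x ∈ M, P x = x := by
  obtain ⟨f, hf⟩ := Submodule.ClosedComplemented.of_finiteDimensional M
  refine ⟨M.subtypeL ∘L f, mem_finRankOps_comp _ _, ?_, ?_⟩
  · ext x
    simp [hf]
  · intro x hx
    exact congrArg Subtype.val (hf ⟨x, hx⟩)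

/-- Finitely many finite-rank operators lie in a corner `Q 𝓑(X) Q` cut out by a finite-rank
idempotent `Q`. -/
theorem exists_finRank_idempotent (s : Finset (X →L[ℂ] X)) (hs : ∀ T ∈ s, T ∈ FinRankOps X) :
    ∃ Q ∈ FinRankOps X, Q * Q = Q ∧ ∀ T ∈ s, Q * T = T ∧ T * Q = T := by
  obtain ⟨P₂, hP₂, hs₂⟩ := exists_finRank_mul_right_eq s hs
  have : FiniteDimensional ℂ (LinearMap.range (P₂ : X →ₗ[ℂ] X)) := hP₂
  have : ∀ T : s, FiniteDimensional ℂ (LinearMap.range (T.1 : X →ₗ[ℂ] X)) :=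
    fun T => hs T T.2
  obtain ⟨P₁, hP₁, h₁, hM⟩ := exists_finRank_mul_left_eq
    ((⨆ T : s, LinearMap.range (T.1 : X →ₗ[ℂ] X)) ⊔ LinearMap.range (P₂ : X →ₗ[ℂ] X))
  have h₁₂ : P₁ * P₂ = P₂ := by
    ext x
    exact hM _ (Submodule.mem_sup_right ⟨x, rfl⟩)
  have h₁T : ∀ T ∈ s, P₁ * T = T := by
    intro T hT
    ext x
    exact hM _ (Submodule.mem_sup_left (Submodule.mem_iSup_of_mem ⟨T, hT⟩ ⟨x, rfl⟩))
  refine ⟨P₁ + P₂ - P₂ * P₁,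
    sub_mem (add_mem hP₁ hP₂) (mul_mem_finRankOps_left hP₂ _), ?_, ?_⟩
  · have e1 : (1 - P₁) * (1 - P₂) = 1 - P₁ := by
      rw [mul_sub, sub_mul, sub_mul, h₁₂]
      simp
    have e2 : (1 - P₁) * (1 - P₁) = 1 - P₁ := IsIdempotentElem.one_sub h₁
    have e3 : IsIdempotentElem ((1 - P₂) * (1 - P₁)) := by
      rw [IsIdempotentElem, mul_assoc, ← mul_assoc (1 - P₁), e1, e2]
    have e4 : P₁ + P₂ - P₂ * P₁ = 1 - (1 - P₂) * (1 - P₁) := by noncomm_ring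
    rw [e4]
    exact e3.one_sub
  · intro T hT
    constructor
    · rw [sub_mul, add_mul, mul_assoc, h₁T T hT]
      abel
    · rw [mul_sub, mul_add, ← mul_assoc, hs₂ T hT]
      abel

/-- Finite-rank operators that are linear combinations of orthogonal finite-rank idempotents. -/
def IsFinRankDiagonal (T : X →L[ℂ] X) : Prop :=
  ∃ (s : Finset ℂ) (e : ℂ → X →L[ℂ] X), (∀ z ∈ s, e z ∈ FinRankOps X) ∧
    (∀ z ∈ s, e z * e z = e z) ∧ (∀ z ∈ s, ∀ w ∈ s, z ≠ w → e z * e w = 0) ∧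
    T = ∑ z ∈ s, z • e z

theorem IsFinRankDiagonal.mem_finRankOps {T : X →L[ℂ] X} (hT : IsFinRankDiagonal T) :
    T ∈ FinRankOps X := by
  obtain ⟨s, e, hfin, -, -, rfl⟩ := hT
  exact Submodule.sum_mem _ fun z hz => Submodule.smul_mem _ _ (hfin z hz)

theorem mem_closure_isFinRankDiagonal {T : X →L[ℂ] X} (hT : T ∈ FinRankOps X) :
    T ∈ closure {S : X →L[ℂ] X | IsFinRankDiagonal S} := by
  obtain ⟨Q, hQ, hQQ, hQT⟩ := exists_finRank_idempotent {T} (by simpa using hT)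
  obtain ⟨hQT, hTQ⟩ := hQT T (by simp)
  have : FiniteDimensional ℂ (LinearMap.range (Q : X →ₗ[ℂ] X)) := hQ
  let V := LinearMap.range (Q : X →ₗ[ℂ] X)
  let p : X →L[ℂ] V := Q.codRestrict _ fun x => ⟨x, rfl⟩
  have hp : ∀ v : V, p v = v := by
    rintro ⟨_, x, rfl⟩
    exact Subtype.ext (DFunLike.congr_fun hQQ x)
  let b := Module.finBasis ℂ V
  let ρ : Matrix (Fin (Module.finrank ℂ V)) (Fin (Module.finrank ℂ V)) ℂ →ₗ[ℂ] (X →L[ℂ] X) :=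
    { toFun := fun B => V.subtypeL ∘L (Matrix.toLinAlgEquiv b B).toContinuousLinearMap ∘L p
      map_add' := fun B B' => by ext x; simp
      map_smul' := fun c B => by ext x; simp }
  have hρ_apply : ∀ B x, ρ B x = (Matrix.toLinAlgEquiv b B (p x) : X) := fun B x => rfl
  have hρmul : ∀ B B', ρ (B * B') = ρ B * ρ B' := by
    intro B B'
    ext x
    simp [hρ_apply, hp]
  have hρfin : ∀ B, ρ B ∈ FinRankOps X := fun B => mem_finRankOps_comp _ _
  have hρT : ρ ((Matrix.toLinAlgEquiv b).symm (p ∘L T ∘L V.subtypeL).toLinearMap) = T := by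
    ext x
    rw [hρ_apply, AlgEquiv.apply_symm_apply]
    have : T (Q x) = T x := DFunLike.congr_fun hTQ x
    have h2 : Q (T x) = T x := DFunLike.congr_fun hQT x
    change Q (T (Q x)) = T x
    rw [this, h2]
  rw [← hρT]
  refine map_mem_closure ρ.continuous_of_finiteDimensional (mem_closure_separable_charpoly _) ?_
  intro B hB
  obtain ⟨e, he, horth, hsum⟩ := exists_orthogonal_idempotents_of_aeval_eq_zero _ B
    (Matrix.aeval_prod_roots_toFinset_of_separable hB)
  refine ⟨B.charpoly.roots.toFinset, fun z => ρ (e z), fun z _ => hρfin _,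
    fun z hz => ?_, fun z hz w hw hzw => ?_, ?_⟩
  · rw [← hρmul, he z hz]
  · rw [← hρmul, horth z hz w hw hzw, map_zero]
  · conv_lhs => rw [hsum]
    simp

end FiniteRank

section LocalReflexivity

set_option maxSynthPendingDepth 3

variable {X : Type*} [NormedAddCommGroup X] [NormedSpace ℂ X]

theorem sum_norm_comp_single_le {ι : Type*} [Fintype ι] [DecidableEq ι] (g : (ι → X) →L[ℂ] ℂ) :
    ∑ k, ‖g ∘L ContinuousLinearMap.single ℂ (fun _ => X) k‖ ≤ ‖g‖ := by
  refine le_of_forall_pos_le_add fun ε hε => ?_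
  set y : ι → X →L[ℂ] ℂ := fun k => g ∘L ContinuousLinearMap.single ℂ (fun _ => X) k with hy
  set δ : ℝ := ε / (Fintype.card ι + 1)
  have hδ : 0 < δ := by positivity
  choose x hx hxy using fun k =>
    (y k).exists_lt_apply_of_lt_opNorm (r := ‖y k‖ - δ) (by linarith)
  choose c hc hcy using fun k => RCLike.exists_norm_eq_mul_self (y k (x k))
  have hg : g (fun k => c k • x k) = ∑ k, (‖y k (x k)‖ : ℂ) := by
    rw [show (fun k => c k • x k) = ∑ k, Pi.single k (c k • x k) from
      (Finset.univ_sum_single _).symm, map_sum]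
    refine Finset.sum_congr rfl fun k _ => ?_
    have : g (Pi.single k (c k • x k)) = y k (c k • x k) := rfl
    rw [this, map_smul, smul_eq_mul]
    exact (hcy k).symm
  have hle : ∑ k, ‖y k (x k)‖ ≤ ‖g‖ := by
    have h1 : ‖g (fun k => c k • x k)‖ = ∑ k, ‖y k (x k)‖ := by
      rw [hg, ← Complex.ofReal_sum, Complex.norm_of_nonneg (by positivity)]
    rw [← h1]
    refine g.unit_le_opNorm _ ((pi_norm_le_iff_of_nonneg zero_le_one).2 fun k => ?_)
    rw [norm_smul, hc, one_mul]
    exact (hx k).le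
  calc ∑ k, ‖y k‖ ≤ ∑ k, (‖y k (x k)‖ + δ) :=
        Finset.sum_le_sum fun k _ => by linarith [hxy k]
    _ = ∑ k, ‖y k (x k)‖ + Fintype.card ι * δ := by
        rw [Finset.sum_add_distrib]; simp
    _ ≤ ‖g‖ + ε := by
        have : Fintype.card ι * δ ≤ ε := by
          rw [mul_div_assoc', div_le_iff₀ (by positivity)]
          nlinarith
        linarith

/-- A functional on `G →L[ℂ] X` with `G` finite-dimensional is nuclear, with control of the
nuclear norm that does not depend on the dimension of `G`. -/
theorem exists_nuclear_representation {G : Type*} [NormedAddCommGroup G] [NormedSpace ℂ G]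
    [FiniteDimensional ℂ G] (τ : (G →L[ℂ] X) →L[ℂ] ℂ) :
    ∃ (t : Finset G) (y : t → X →L[ℂ] ℂ), (∀ g ∈ t, ‖g‖ ≤ 1) ∧
      (∀ R, τ R = ∑ g : t, y g (R g)) ∧ ∑ g : t, ‖y g‖ ≤ 2 * ‖τ‖ := by
  classical
  have : ProperSpace G := FiniteDimensional.proper ℂ G
  obtain ⟨t, ht, htf, hcov⟩ := (isCompact_closedBall (0 : G) 1).finite_cover_balls
    (e := 1 / 2) (by norm_num)
  lift t to Finset G using htf
  let j : (G →L[ℂ] X) →ₗ[ℂ] (t → X) :=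
    { toFun := fun R g => R g
      map_add' := fun _ _ => rfl
      map_smul' := fun _ _ => rfl }
  have hj : ∀ R, ‖R‖ ≤ 2 * ‖j R‖ := by
    intro R
    have h : ‖R‖ ≤ ‖j R‖ + ‖R‖ / 2 := by
      refine ContinuousLinearMap.opNorm_le_of_unit_norm (by positivity) fun v hv => ?_
      have hv' : v ∈ Metric.closedBall (0 : G) 1 := by simp [hv]
      obtain ⟨g, hg, hvg⟩ := Set.mem_iUnion₂.1 (hcov hv')
      have h1 : ‖R g‖ ≤ ‖j R‖ := norm_le_pi_norm (j R) ⟨g, hg⟩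
      have h2 : ‖R (v - g)‖ ≤ ‖R‖ * (1 / 2) :=
        R.le_of_opNorm_le_of_le le_rfl (by rw [← dist_eq_norm]; exact hvg.le)
      calc ‖R v‖ = ‖R g + R (v - g)‖ := by rw [← map_add]; simp
        _ ≤ ‖R g‖ + ‖R (v - g)‖ := norm_add_le _ _
        _ ≤ _ := by linarith
    linarith
  have hτ : ∀ R, ‖τ.toLinearMap R‖ ≤ (2 * ‖τ‖) * ‖j.rangeRestrict R‖ := by
    intro R
    calc ‖τ R‖ ≤ ‖τ‖ * ‖R‖ := τ.le_opNorm R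
      _ ≤ ‖τ‖ * (2 * ‖j R‖) := by gcongr; exact hj R
      _ = (2 * ‖τ‖) * ‖j R‖ := by ring
  have hdense : DenseRange j.rangeRestrict := j.surjective_rangeRestrict.denseRange
  let σ : LinearMap.range j →L[ℂ] ℂ := τ.toLinearMap.extendOfNorm j.rangeRestrict
  have hσ : ∀ R, σ (j.rangeRestrict R) = τ R := fun R =>
    LinearMap.extendOfNorm_eq hdense ⟨_, hτ⟩ R
  have hσn : ‖σ‖ ≤ 2 * ‖τ‖ := LinearMap.opNorm_extendOfNorm_le hdense (by positivity) hτ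
  obtain ⟨g, hg, hgn⟩ := exists_extension_norm_eq _ σ
  refine ⟨t, fun k => g ∘L ContinuousLinearMap.single ℂ (fun _ => X) k, fun v hv => ?_,
    fun R => ?_, ?_⟩
  · simpa using ht hv
  · rw [← hσ, ← hg, show (j.rangeRestrict R : t → X) = j R from rfl,
      show j R = ∑ k, Pi.single k (j R k) from (Finset.univ_sum_single _).symm, map_sum]
    rfl
  · exact (sum_norm_comp_single_le g).trans (hgn.le.trans hσn)

/-- A quantitative form of local reflexivity: a functional bounded on the adjoints of finite-rank
operators on `X` is bounded on all operators on the dual of `X` that factor through a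
finite-dimensional space `W`. -/
theorem norm_sum_apply_le_of_factors {W : Type*} [NormedAddCommGroup W] [NormedSpace ℂ W]
    [FiniteDimensional ℂ W] {ι : Type*} [Fintype ι] (h : ι → X →L[ℂ] ℂ)
    (ψ : ι → (X →L[ℂ] ℂ) →L[ℂ] ℂ) {u : ℝ} (hu : 0 ≤ u)
    (hle : ∀ E ∈ FinRankOps X, ‖E‖ ≤ 1 → ‖∑ k, ψ k (h k ∘L E)‖ ≤ u)
    (S : (X →L[ℂ] ℂ) →L[ℂ] W) (i : W →L[ℂ] (X →L[ℂ] ℂ)) (hi : ‖i‖ ≤ 1) :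
    ‖∑ k, ψ k (i (S (h k)))‖ ≤ 2 * ‖S‖ * u := by
  let J : X →L[ℂ] (W →L[ℂ] ℂ) := i.flip
  have hJ : ‖J‖ ≤ 1 := (i.opNorm_flip).le.trans hi
  let τ : ((W →L[ℂ] ℂ) →L[ℂ] X) →L[ℂ] ℂ :=
    LinearMap.mkContinuous
      { toFun := fun R => ∑ k, ψ k (h k ∘L (R ∘L J))
        map_add' := fun R R' => by
          simp [ContinuousLinearMap.add_comp, Finset.sum_add_distrib]
        map_smul' := fun c R => by
          simp [Finset.mul_sum] } u fun R => by
      change ‖∑ k, ψ k (h k ∘L (R ∘L J))‖ ≤ u * ‖R‖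
      rcases eq_or_ne R 0 with rfl | hR
      · simp
      have hR' : 0 < ‖R‖ := norm_pos_iff.2 hR
      have h1 := hle ((((‖R‖⁻¹ : ℝ) : ℂ) • R) ∘L J) (mem_finRankOps_comp _ _) (by
        refine (ContinuousLinearMap.opNorm_comp_le _ _).trans ?_
        rw [norm_smul, Complex.norm_real, norm_inv, norm_norm, inv_mul_cancel₀ hR'.ne', one_mul]
        exact hJ)
      have h2 : ∑ k, ψ k (h k ∘L ((((‖R‖⁻¹ : ℝ) : ℂ) • R) ∘L J)) =
          ((‖R‖⁻¹ : ℝ) : ℂ) * ∑ k, ψ k (h k ∘L (R ∘L J)) := by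
        simp [Finset.mul_sum]
      rw [h2, norm_mul, Complex.norm_real, norm_inv, norm_norm, inv_mul_le_iff₀ hR'] at h1
      linarith
  have hτn : ‖τ‖ ≤ u := LinearMap.mkContinuous_norm_le _ hu _
  obtain ⟨t, y, ht, hty, hy⟩ := exists_nuclear_representation τ
  have key : ∀ f : W, ∑ k, ψ k (i f) • h k = ∑ g : t, g.1 f • y g := by
    intro f
    ext x
    have h1 := hty ((ContinuousLinearMap.apply ℂ ℂ f).smulRight x)
    have h2 : ∀ k, h k ∘L ((ContinuousLinearMap.apply ℂ ℂ f).smulRight x ∘L J) =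
        h k x • i f := by
      intro k
      ext z
      simp [J, mul_comm]
    change ∑ k, ψ k (h k ∘L ((ContinuousLinearMap.apply ℂ ℂ f).smulRight x ∘L J)) = _ at h1
    simp only [h2, map_smul, smul_eq_mul] at h1
    simpa [mul_comm] using h1
  let b := Module.finBasis ℂ W
  let s : Fin (Module.finrank ℂ W) → (X →L[ℂ] ℂ) →ₗ[ℂ] ℂ := fun m => b.coord m ∘ₗ S.toLinearMap
  have hs : ∀ f, S f = ∑ m, s m f • b m := fun f => (b.sum_repr (S f)).symm
  have hmain : ∑ k, ψ k (i (S (h k))) = ∑ g : t, g.1 (S (y g)) := by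
    have hL : ∀ k, ψ k (i (S (h k))) = ∑ m, s m (h k) * ψ k (i (b m)) := by
      intro k
      rw [hs]
      simp
    have hR : ∀ g : t, g.1 (S (y g)) = ∑ m, s m (y g) * g.1 (b m) := by
      intro g
      rw [hs]
      simp
    simp only [hL, hR]
    rw [Finset.sum_comm, Finset.sum_comm (s := (Finset.univ : Finset t))]
    refine Finset.sum_congr rfl fun m _ => ?_
    have := congrArg (s m) (key (b m))
    simpa [mul_comm] using this
  rw [hmain]
  calc ‖∑ g : t, g.1 (S (y g))‖ ≤ ∑ g : t, ‖g.1 (S (y g))‖ := norm_sum_le _ _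
    _ ≤ ∑ g : t, ‖S‖ * ‖y g‖ := by
        refine Finset.sum_le_sum fun g _ => ?_
        calc ‖g.1 (S (y g))‖ ≤ 1 * ‖S (y g)‖ := g.1.le_of_opNorm_le (ht g g.2) _
          _ ≤ ‖S‖ * ‖y g‖ := by
            rw [one_mul]
            exact S.le_opNorm (y g)
    _ = ‖S‖ * ∑ g : t, ‖y g‖ := by rw [Finset.mul_sum]
    _ ≤ ‖S‖ * (2 * u) := by gcongr; exact hy.trans (by gcongr)
    _ = 2 * ‖S‖ * u := by ring

theorem norm_sum_apply_le_of_finRank {ι : Type*} [Fintype ι] (h : ι → X →L[ℂ] ℂ)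
    (ψ : ι → (X →L[ℂ] ℂ) →L[ℂ] ℂ) {u : ℝ} (hu : 0 ≤ u)
    (hle : ∀ E ∈ FinRankOps X, ‖E‖ ≤ 1 → ‖∑ k, ψ k (h k ∘L E)‖ ≤ u)
    (S : (X →L[ℂ] ℂ) →L[ℂ] (X →L[ℂ] ℂ))
    (hS : FiniteDimensional ℂ (LinearMap.range (S : (X →L[ℂ] ℂ) →ₗ[ℂ] (X →L[ℂ] ℂ)))) :
    ‖∑ k, ψ k (S (h k))‖ ≤ 2 * ‖S‖ * u := by
  have hn : ‖S.codRestrict (LinearMap.range (S : (X →L[ℂ] ℂ) →ₗ[ℂ] (X →L[ℂ] ℂ)))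
      fun x => ⟨x, rfl⟩‖ ≤ ‖S‖ :=
    ContinuousLinearMap.opNorm_le_bound _ (norm_nonneg _) fun f => S.le_opNorm f
  refine (norm_sum_apply_le_of_factors h ψ hu hle (S.codRestrict
    (LinearMap.range (S : (X →L[ℂ] ℂ) →ₗ[ℂ] (X →L[ℂ] ℂ))) fun x => ⟨x, rfl⟩)
    (Submodule.subtypeL _) (Submodule.norm_subtypeL_le _)).trans ?_
  gcongr

end LocalReflexivity

section BoundedApproximateIdentity

set_option maxSynthPendingDepth 3

variable {X : Type*} [NormedAddCommGroup X] [NormedSpace ℂ X]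

theorem exists_eq_sum_smulRight {Q : X →L[ℂ] X} (hQ : Q ∈ FinRankOps X) :
    ∃ (m : ℕ) (q : Fin m → X →L[ℂ] ℂ) (b : Fin m → X), Q = ∑ i, (q i).smulRight (b i) := by
  have : FiniteDimensional ℂ (LinearMap.range (Q : X →ₗ[ℂ] X)) := hQ
  let b := Module.finBasis ℂ (LinearMap.range (Q : X →ₗ[ℂ] X))
  let Q' := Q.codRestrict (LinearMap.range (Q : X →ₗ[ℂ] X)) fun x => ⟨x, rfl⟩
  refine ⟨_, fun i => (LinearMap.toContinuousLinearMap (b.coord i)) ∘L Q', fun i => b i, ?_⟩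
  ext x
  have := congrArg Subtype.val (b.sum_repr (Q' x))
  simp only [Submodule.coe_sum, Submodule.coe_smul] at this
  rw [sum_apply]
  exact this.symm

/-- A functional of the pair `(E * Q, Q * E)`, with `Q` of finite rank, depends on `E` through
finitely many values of the adjoint of `E`. -/
theorem exists_sum_apply_comp_eq {Q : X →L[ℂ] X} (hQ : Q ∈ FinRankOps X)
    (f : ((X →L[ℂ] X) × (X →L[ℂ] X)) →L[ℂ] ℂ) :
    ∃ (m : ℕ) (h : Fin m ⊕ Fin m → X →L[ℂ] ℂ) (ψ : Fin m ⊕ Fin m → (X →L[ℂ] ℂ) →L[ℂ] ℂ),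
      ∀ E : X →L[ℂ] X, f (E * Q, Q * E) = ∑ k, ψ k (h k ∘L E) := by
  obtain ⟨m, q, b, rfl⟩ := exists_eq_sum_smulRight hQ
  refine ⟨m, Sum.elim
      (fun i => (f ∘L .inl ℂ _ _) ∘L ContinuousLinearMap.smulRightL ℂ X X (q i)) q,
    Sum.elim (fun i => ContinuousLinearMap.apply ℂ ℂ (b i))
      (fun i => (f ∘L .inr ℂ _ _) ∘L (ContinuousLinearMap.smulRightL ℂ X X).flip (b i)),
    fun E => ?_⟩
  have h1 : E * ∑ i, (q i).smulRight (b i) = ∑ i, (q i).smulRight (E (b i)) := by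
    ext x
    simp
  have h2 : (∑ i, (q i).smulRight (b i)) * E = ∑ i, (q i ∘L E).smulRight (b i) := by
    ext x
    simp
  have h3 : ∀ S T : X →L[ℂ] X, f (S, T) = (f ∘L .inl ℂ _ _) S + (f ∘L .inr ℂ _ _) T := by
    intro S T
    simp [← map_add]
  rw [h3, h1, h2, map_sum, map_sum, Fintype.sum_sum_type]
  rfl

theorem norm_apply_le_of_forall_norm_le {Q : X →L[ℂ] X} (hQ : Q ∈ FinRankOps X) {C : ℝ}
    (hC : 0 < C)
    (hBAP : ∀ (F : Finset (X →L[ℂ] ℂ)) (ε : ℝ), 0 < ε →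
      ∃ S : (X →L[ℂ] ℂ) →L[ℂ] (X →L[ℂ] ℂ),
        FiniteDimensional ℂ (LinearMap.range (S : (X →L[ℂ] ℂ) →ₗ[ℂ] (X →L[ℂ] ℂ))) ∧
        ‖S‖ ≤ C ∧ ∀ f ∈ F, ‖S f - f‖ < ε)
    (f : ((X →L[ℂ] X) × (X →L[ℂ] X)) →L[ℂ] ℂ) {v : ℝ} (hv : 0 ≤ v)
    (hle : ∀ E ∈ FinRankOps X, ‖E‖ ≤ 2 * C → ‖f (E * Q, Q * E)‖ ≤ v) : ‖f (Q, Q)‖ ≤ v := by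
  classical
  obtain ⟨m, h, ψ, hψ⟩ := exists_sum_apply_comp_eq hQ f
  have h1 : f (Q, Q) = ∑ k, ψ k (h k) := by
    have := hψ 1
    rwa [one_mul, mul_one] at this
  have h2 : ∀ E ∈ FinRankOps X, ‖E‖ ≤ 1 → ‖∑ k, ψ k (h k ∘L E)‖ ≤ v / (2 * C) := by
    intro E hE hE1
    have := hle (((2 * C : ℝ) : ℂ) • E) (Submodule.smul_mem _ _ hE) (by
      rw [norm_smul, Complex.norm_of_nonneg (by positivity)]
      exact mul_le_of_le_one_right (by positivity) hE1)
    rw [smul_mul_assoc, mul_smul_comm, ← Prod.smul_mk, map_smul, norm_smul,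
      Complex.norm_of_nonneg (by positivity), hψ] at this
    rwa [le_div_iff₀' (by positivity)]
  refine le_of_forall_pos_le_add fun δ hδ => ?_
  obtain ⟨S, hS, hSC, hSh⟩ := hBAP (Finset.univ.image h) (δ / (1 + ∑ k, ‖ψ k‖)) (by positivity)
  have h3 := norm_sum_apply_le_of_finRank h ψ (by positivity) h2 S hS
  have h4 : 2 * ‖S‖ * (v / (2 * C)) ≤ v := by
    calc 2 * ‖S‖ * (v / (2 * C)) ≤ 2 * C * (v / (2 * C)) := by gcongr
      _ = v := by field_simp
  have h5 : ‖∑ k, ψ k (S (h k) - h k)‖ ≤ δ := by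
    calc ‖∑ k, ψ k (S (h k) - h k)‖ ≤ ∑ k, ‖ψ k (S (h k) - h k)‖ := norm_sum_le _ _
      _ ≤ ∑ k, ‖ψ k‖ * (δ / (1 + ∑ k, ‖ψ k‖)) :=
        Finset.sum_le_sum fun k _ => (ψ k).le_of_opNorm_le_of_le le_rfl
          (hSh _ (Finset.mem_image_of_mem _ (Finset.mem_univ _))).le
      _ = (∑ k, ‖ψ k‖) * (δ / (1 + ∑ k, ‖ψ k‖)) := by rw [Finset.sum_mul]
      _ ≤ δ := by
        rw [mul_div_assoc', div_le_iff₀ (by positivity)]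
        nlinarith
  calc ‖f (Q, Q)‖ = ‖∑ k, ψ k (S (h k)) - ∑ k, ψ k (S (h k) - h k)‖ := by
        rw [h1, ← Finset.sum_sub_distrib]
        simp
    _ ≤ ‖∑ k, ψ k (S (h k))‖ + ‖∑ k, ψ k (S (h k) - h k)‖ := norm_sub_le _ _
    _ ≤ v + δ := by linarith

theorem exists_finRank_approx_unit {Q : X →L[ℂ] X} (hQ : Q ∈ FinRankOps X) {C : ℝ}
    (hC : 0 < C)
    (hBAP : ∀ (F : Finset (X →L[ℂ] ℂ)) (ε : ℝ), 0 < ε →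
      ∃ S : (X →L[ℂ] ℂ) →L[ℂ] (X →L[ℂ] ℂ),
        FiniteDimensional ℂ (LinearMap.range (S : (X →L[ℂ] ℂ) →ₗ[ℂ] (X →L[ℂ] ℂ))) ∧
        ‖S‖ ≤ C ∧ ∀ f ∈ F, ‖S f - f‖ < ε) {ε : ℝ} (hε : 0 < ε) :
    ∃ E ∈ FinRankOps X, ‖E‖ ≤ 2 * C ∧ ‖E * Q - Q‖ < ε ∧ ‖Q * E - Q‖ < ε := by
  let g : (X →L[ℂ] X) →ₗ[ℝ] ((X →L[ℂ] X) × (X →L[ℂ] X)) :=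
    { toFun := fun E => (E * Q, Q * E)
      map_add' := fun E E' => by simp [add_mul, mul_add]
      map_smul' := fun c E => by simp }
  set s : Set (X →L[ℂ] X) := {E | E ∈ FinRankOps X ∧ ‖E‖ ≤ 2 * C} with hs
  have hconv : Convex ℝ s := by
    have h1 : Convex ℝ ((FinRankOps X).restrictScalars ℝ : Set (X →L[ℂ] X)) :=
      Submodule.convex _
    have h2 := h1.inter (convex_closedBall (0 : X →L[ℂ] X) (2 * C))
    convert h2 using 1
    ext E
    simp [hs]
  have hmem : (Q, Q) ∈ closure (g '' s) := by
    by_contra hQs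
    obtain ⟨f, v, hfv, hvf⟩ := RCLike.geometric_hahn_banach_closed_point (𝕜 := ℂ)
      (hconv.linear_image g).closure isClosed_closure hQs
    have hlt : ∀ E ∈ s, RCLike.re (f (E * Q, Q * E)) < v := fun E hE =>
      hfv _ (subset_closure ⟨E, hE, rfl⟩)
    have hv : 0 ≤ v := by
      have := hlt 0 ⟨Submodule.zero_mem _, by simpa using hC.le⟩
      rw [zero_mul, mul_zero, Prod.mk_zero_zero, map_zero, map_zero] at this
      exact this.le
    have hle : ∀ E ∈ FinRankOps X, ‖E‖ ≤ 2 * C → ‖f (E * Q, Q * E)‖ ≤ v := by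
      intro E hE hEC
      obtain ⟨c, hc, hcE⟩ := RCLike.exists_norm_eq_mul_self (f (E * Q, Q * E))
      have := hlt (c • E) ⟨Submodule.smul_mem _ _ hE, by rwa [norm_smul, hc, one_mul]⟩
      rw [smul_mul_assoc, mul_smul_comm, ← Prod.smul_mk, map_smul, smul_eq_mul, ← hcE,
        RCLike.ofReal_re] at this
      exact this.le
    have h1 := norm_apply_le_of_forall_norm_le hQ hC hBAP f hv hle
    exact absurd (hvf.trans_le (RCLike.re_le_norm _)) h1.not_gt
  obtain ⟨_, ⟨E, ⟨hE, hEC⟩, rfl⟩, hEQ⟩ := Metric.mem_closure_iff.1 hmem ε hε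
  rw [dist_comm, dist_eq_norm] at hEQ
  exact ⟨E, hE, hEC, (norm_fst_le _).trans_lt hEQ, (norm_snd_le _).trans_lt hEQ⟩

/-- If the dual of `X` has the bounded approximation property, then finite sets of finite-rank
operators have exact two-sided finite-rank units with a uniform norm bound. -/
theorem DualHasBAP.exists_finRank_unit (hBAP : DualHasBAP X) :
    ∃ K : ℝ, ∀ s : Finset (X →L[ℂ] X), (∀ T ∈ s, T ∈ FinRankOps X) →
      ∃ E ∈ FinRankOps X, ‖E‖ ≤ K ∧ ∀ T ∈ s, E * T = T ∧ T * E = T := by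
  obtain ⟨C, hC, h⟩ := hBAP
  refine ⟨2 * C + 3, fun s hs => ?_⟩
  obtain ⟨Q, hQ, hQQ, hQs⟩ := exists_finRank_idempotent s hs
  obtain ⟨E, hE, hEC, hl, hr⟩ := exists_finRank_approx_unit hQ hC h
    (ε := 1 / (1 + ‖Q‖)) (by positivity)
  have hε : 1 / (1 + ‖Q‖) ≤ 1 := by
    rw [div_le_one (by positivity)]
    linarith [norm_nonneg Q]
  have hεQ : 1 / (1 + ‖Q‖) * ‖Q‖ ≤ 1 := by
    rw [div_mul_eq_mul_div, div_le_one (by positivity)]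
    linarith
  refine ⟨E - (Q * E - Q) - (E * Q - Q) + (Q * E - Q) * Q, ?_, ?_, fun T hT => ?_⟩
  · refine Submodule.add_mem _ (Submodule.sub_mem _ (Submodule.sub_mem _ hE ?_) ?_)
      (mul_mem_finRankOps_right hQ _)
    · exact Submodule.sub_mem _ (mul_mem_finRankOps_left hQ _) hQ
    · exact Submodule.sub_mem _ (mul_mem_finRankOps_right hQ _) hQ
  · have h1 : ‖(Q * E - Q) * Q‖ ≤ 1 := by
      refine (norm_mul_le _ _).trans (le_trans ?_ hεQ)
      gcongr
    have h2 := norm_add_le (E - (Q * E - Q) - (E * Q - Q)) ((Q * E - Q) * Q)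
    have h3 := norm_sub_le (E - (Q * E - Q)) (E * Q - Q)
    have h4 := norm_sub_le E (Q * E - Q)
    linarith
  · obtain ⟨h1, h2⟩ := hQs T hT
    constructor
    · calc _ = E * T - (Q * E - Q) * T - (E * (Q * T) - Q * T) + (Q * E - Q) * (Q * T) := by
            noncomm_ring
        _ = T := by rw [h1]; abel
    · calc _ = T * E - ((T * Q) * E - T * Q) - (T * E * Q - T * Q) +
              ((T * Q) * E - T * Q) * Q := by noncomm_ring
        _ = T := by rw [h2, sub_mul, h2]; abel

end BoundedApproximateIdentity

section Polynomial

set_option maxSynthPendingDepth 3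

variable {X Y : Type*} [NormedAddCommGroup X] [NormedSpace ℂ X]
  [NormedAddCommGroup Y] [NormedSpace ℂ Y] {n : ℕ}

theorem finRankOps_le_approxOps : FinRankOps X ≤ ApproxOps X :=
  Submodule.le_topologicalClosure _

theorem mul_mem_approxOps {T : X →L[ℂ] X} (hT : T ∈ ApproxOps X) (S : X →L[ℂ] X) :
    T * S ∈ ApproxOps X :=
  map_mem_closure (f := fun T => T * S) (by fun_prop) hT fun _ h => mul_mem_finRankOps_left h S

theorem pow_mem_approxOps {T : X →L[ℂ] X} (hT : T ∈ ApproxOps X) (hn : 0 < n) :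
    T ^ n ∈ ApproxOps X := by
  obtain ⟨m, rfl⟩ := Nat.exists_eq_succ_of_ne_zero hn.ne'
  rw [pow_succ']
  exact mul_mem_approxOps hT _

/-- Orthogonal additivity of the homogeneous polynomial associated with `φ`. -/
def IsOrthogonallyAdditive
    (φ : ContinuousMultilinearMap ℂ (fun _ : Fin n => ↥(ApproxOps X)) Y) : Prop :=
  ∀ S T : ↥(ApproxOps X), (S : X →L[ℂ] X) * (T : X →L[ℂ] X) = 0 →
    (T : X →L[ℂ] X) * (S : X →L[ℂ] X) = 0 →
    φ (fun _ => S + T) = φ (fun _ => S) + φ (fun _ => T)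

theorem ContinuousMultilinearMap.map_const_smul {V : Type*} [AddCommMonoid V] [Module ℂ V]
    [TopologicalSpace V] (φ : ContinuousMultilinearMap ℂ (fun _ : Fin n => V) Y) (c : ℂ) (T : V) :
    φ (fun _ => c • T) = c ^ n • φ (fun _ => T) := by
  simpa using φ.map_smul_univ (fun _ => c) (fun _ => T)

variable {φ : ContinuousMultilinearMap ℂ (fun _ : Fin n => ↥(ApproxOps X)) Y}

theorem IsOrthogonallyAdditive.map_sum (hφ : IsOrthogonallyAdditive φ) (hn : 0 < n)
    {ι : Type*} (s : Finset ι) (e : ι → ↥(ApproxOps X))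
    (he : ∀ i ∈ s, ∀ j ∈ s, i ≠ j → (e i : X →L[ℂ] X) * (e j : X →L[ℂ] X) = 0) :
    φ (fun _ => ∑ i ∈ s, e i) = ∑ i ∈ s, φ (fun _ => e i) := by
  classical
  induction s using Finset.induction_on with
  | empty =>
    have : Nonempty (Fin n) := ⟨⟨0, hn⟩⟩
    exact φ.map_zero
  | insert a s ha ih =>
    have hne : ∀ i ∈ s, i ≠ a := fun i hi h => ha (h ▸ hi)
    simp only [Finset.sum_insert ha]
    rw [hφ, ih fun i hi j hj => he i (by simp [hi]) j (by simp [hj])]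
    · rw [Submodule.coe_sum, Finset.mul_sum]
      exact Finset.sum_eq_zero fun i hi => he a (by simp) i (by simp [hi]) (hne i hi).symm
    · rw [Submodule.coe_sum, Finset.sum_mul]
      exact Finset.sum_eq_zero fun i hi => he i (by simp [hi]) a (by simp) (hne i hi)

theorem IsOrthogonallyAdditive.linearDeriv_apply_idempotent (hφ : IsOrthogonallyAdditive φ)
    {E e : ↥(ApproxOps X)} (he : (e : X →L[ℂ] X) * (e : X →L[ℂ] X) = e)
    (hl : (E : X →L[ℂ] X) * (e : X →L[ℂ] X) = e) (hr : (e : X →L[ℂ] X) * (E : X →L[ℂ] X) = e) :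
    φ.linearDeriv (fun _ => E) (fun _ => e) = (n : ℂ) • φ (fun _ => e) := by
  have h1 : HasDerivAt (fun z : ℂ => φ (fun _ => E + z • e))
      (φ.linearDeriv (fun _ => E) (fun _ => e)) 0 := by
    have hd : HasDerivAt (fun z : ℂ => fun _ : Fin n => E + z • e) (fun _ => e) 0 := by
      refine hasDerivAt_pi.2 fun _ => ?_
      simpa using ((hasDerivAt_id (0 : ℂ)).smul_const e).const_add E
    have hf := φ.hasFDerivAt (fun _ => E + (0 : ℂ) • e)
    have := hf.comp_hasDerivAt (0 : ℂ) hd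
    rw [zero_smul, add_zero] at this
    exact this
  have h2 : HasDerivAt (fun z : ℂ => (1 + z) ^ n • φ (fun _ => e) + φ (fun _ => E - e))
      ((n : ℂ) • φ (fun _ => e)) 0 := by
    have hd : HasDerivAt (fun z : ℂ => (1 + z) ^ n) (n : ℂ) 0 := by
      simpa using ((hasDerivAt_id (0 : ℂ)).const_add 1).fun_pow n
    exact (hd.smul_const _).add_const _
  refine h1.unique (h2.congr_of_eventuallyEq (Eventually.of_forall fun z => ?_))
  have h3 : E + z • e = (1 + z) • e + (E - e) := by
    rw [add_smul, one_smul]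
    abel
  simp only [h3]
  rw [hφ, ContinuousMultilinearMap.map_const_smul]
  · rw [Submodule.coe_smul, Submodule.coe_sub, smul_mul_assoc, mul_sub, hr, he, sub_self,
      smul_zero]
  · rw [Submodule.coe_smul, Submodule.coe_sub, mul_smul_comm, sub_mul, hl, he, sub_self,
      smul_zero]

theorem ContinuousMultilinearMap.norm_linearDeriv_const_le {V : Type*} [NormedAddCommGroup V]
    [NormedSpace ℂ V] (φ : ContinuousMultilinearMap ℂ (fun _ : Fin n => V) Y) (E T : V) :
    ‖φ.linearDeriv (fun _ => E) (fun _ => T)‖ ≤ n * (‖φ‖ * ‖E‖ ^ (n - 1) * ‖T‖) := by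
  rw [ContinuousMultilinearMap.linearDeriv_apply]
  refine (norm_sum_le _ _).trans ((Finset.sum_le_card_nsmul _ _
    (‖φ‖ * ‖E‖ ^ (n - 1) * ‖T‖) fun i _ => ?_).trans (by simp))
  refine (φ.le_opNorm _).trans_eq ?_
  rw [← Finset.prod_erase_mul _ _ (Finset.mem_univ i), Finset.prod_congr rfl (g := fun _ => ‖E‖)]
  · simp [mul_assoc]
  · intro j hj
    rw [Function.update_of_ne (Finset.ne_of_mem_erase hj)]

/-- The idempotents of finite rank, as elements of the algebra of approximable operators. -/
abbrev FinRankIdempotent (X : Type*) [NormedAddCommGroup X] [NormedSpace ℂ X] : Type _ :=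
  {e : ↥(ApproxOps X) // (e : X →L[ℂ] X) ∈ FinRankOps X ∧
    (e : X →L[ℂ] X) * (e : X →L[ℂ] X) = e}

theorem IsOrthogonallyAdditive.exists_bound_linearCombination (hφ : IsOrthogonallyAdditive φ)
    (hn : 0 < n) (hBAP : DualHasBAP X) :
    ∃ M : ℝ, ∀ c : FinRankIdempotent X →₀ ℂ,
      ‖Finsupp.linearCombination ℂ (fun e : FinRankIdempotent X => φ fun _ => e.1) c‖ ≤
        M * ‖Finsupp.linearCombination ℂ (fun e : FinRankIdempotent X => e.1) c‖ := by
  classical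
  obtain ⟨K, hK⟩ := hBAP.exists_finRank_unit
  refine ⟨‖φ‖ * K ^ (n - 1), fun c => ?_⟩
  obtain ⟨E, hE, hEK, hEc⟩ := hK (c.support.image fun e => (e.1 : X →L[ℂ] X)) (by
    intro T hT
    obtain ⟨e, -, rfl⟩ := Finset.mem_image.1 hT
    exact e.2.1)
  let E' : ↥(ApproxOps X) := ⟨E, finRankOps_le_approxOps hE⟩
  let D : ↥(ApproxOps X) →ₗ[ℂ] Y :=
    { toFun := fun T => φ.linearDeriv (fun _ => E') (fun _ => T)
      map_add' := fun S T => (φ.linearDeriv (fun _ => E')).map_add (fun _ => S) (fun _ => T)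
      map_smul' := fun z T => (φ.linearDeriv (fun _ => E')).map_smul z (fun _ => T) }
  have hD : D (Finsupp.linearCombination ℂ (fun e : FinRankIdempotent X => e.1) c) =
      (n : ℂ) • Finsupp.linearCombination ℂ
        (fun e : FinRankIdempotent X => φ fun _ => e.1) c := by
    rw [Finsupp.linearCombination_apply, Finsupp.linearCombination_apply, Finsupp.sum,
      Finsupp.sum, _root_.map_sum, Finset.smul_sum]
    refine Finset.sum_congr rfl fun e he => ?_
    obtain ⟨h1, h2⟩ := hEc _ (Finset.mem_image_of_mem _ he)
    rw [map_smul, smul_comm]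
    exact congrArg _ (hφ.linearDeriv_apply_idempotent (E := E') e.2.2 h1 h2)
  have h1 := φ.norm_linearDeriv_const_le E'
    (Finsupp.linearCombination ℂ (fun e : FinRankIdempotent X => e.1) c)
  rw [show φ.linearDeriv (fun _ => E') (fun _ => _) = D _ from rfl, hD, norm_smul,
    Complex.norm_natCast] at h1
  refine (le_of_mul_le_mul_left h1 (by exact_mod_cast hn)).trans ?_
  have : ‖E'‖ ≤ K := hEK
  gcongr

theorem mem_closure_isFinRankDiagonal_val (T : ↥(ApproxOps X)) :
    T ∈ closure {S : ↥(ApproxOps X) | IsFinRankDiagonal (S : X →L[ℂ] X)} := by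
  have h1 : (T : X →L[ℂ] X) ∈ closure {S : X →L[ℂ] X | IsFinRankDiagonal S} :=
    closure_minimal (fun _ => mem_closure_isFinRankDiagonal) isClosed_closure T.2
  rw [closure_subtype]
  refine closure_mono (fun S hS => ?_) h1
  exact ⟨⟨S, finRankOps_le_approxOps (IsFinRankDiagonal.mem_finRankOps hS)⟩, hS, rfl⟩

theorem IsFinRankDiagonal.exists_approxOps {T : ↥(ApproxOps X)}
    (hT : IsFinRankDiagonal (T : X →L[ℂ] X)) :
    ∃ (s : Finset ℂ) (e : ℂ → FinRankIdempotent X),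
      (∀ z ∈ s, ∀ w ∈ s, z ≠ w → ((e z).1 : X →L[ℂ] X) * ((e w).1 : X →L[ℂ] X) = 0) ∧
      T = ∑ z ∈ s, z • (e z).1 := by
  classical
  obtain ⟨s, e, hfin, hidem, horth, hsum⟩ := hT
  let e' : ℂ → FinRankIdempotent X := fun z =>
    if hz : z ∈ s then ⟨⟨e z, finRankOps_le_approxOps (hfin z hz)⟩, hfin z hz, hidem z hz⟩
    else ⟨0, Submodule.zero_mem _, mul_zero _⟩
  have he' : ∀ z ∈ s, ((e' z).1 : X →L[ℂ] X) = e z := fun z hz => by simp [e', hz]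
  refine ⟨s, e', fun z hz w hw hzw => ?_, ?_⟩
  · rw [he' z hz, he' w hw, horth z hz w hw hzw]
  · ext1
    rw [hsum, Submodule.coe_sum]
    exact Finset.sum_congr rfl fun z hz => by rw [Submodule.coe_smul, he' z hz]

theorem denseRange_linearCombination_finRankIdempotent :
    DenseRange (Finsupp.linearCombination ℂ (fun e : FinRankIdempotent X => e.1)) := by
  intro T
  refine closure_mono (fun S hS => ?_) (mem_closure_isFinRankDiagonal_val T)
  obtain ⟨s, e, -, rfl⟩ := IsFinRankDiagonal.exists_approxOps hS
  refine ⟨∑ z ∈ s, Finsupp.single (e z) z, ?_⟩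
  simp

theorem sum_smul_pow_of_orthogonal {R ι : Type*} [Ring R] [Algebra ℂ R] (s : Finset ι)
    (c : ι → ℂ) (e : ι → R) (hidem : ∀ i ∈ s, e i * e i = e i)
    (horth : ∀ i ∈ s, ∀ j ∈ s, i ≠ j → e i * e j = 0) (hn : 0 < n) :
    (∑ i ∈ s, c i • e i) ^ n = ∑ i ∈ s, c i ^ n • e i := by
  induction n, hn using Nat.le_induction with
  | base => simp
  | succ m _ ih =>
    rw [pow_succ, ih, Finset.sum_mul]
    refine Finset.sum_congr rfl fun i hi => ?_
    rw [Finset.mul_sum, Finset.sum_eq_single i]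
    · rw [smul_mul_smul_comm, hidem i hi, pow_succ]
    · intro j hj hji
      rw [smul_mul_smul_comm, horth i hi j hj hji.symm, smul_zero]
    · exact fun h => absurd hi h

theorem IsOrthogonallyAdditive.existsUnique_linear [CompleteSpace Y]
    (hφ : IsOrthogonallyAdditive φ) (hn : 0 < n) (hBAP : DualHasBAP X) :
    ∃! Φ : ↥(ApproxOps X) →L[ℂ] Y, ∀ T Tn : ↥(ApproxOps X),
      (Tn : X →L[ℂ] X) = (T : X →L[ℂ] X) ^ n → φ (fun _ => T) = Φ Tn := by
  set j := Finsupp.linearCombination ℂ (fun e : FinRankIdempotent X => e.1) with hj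
  set L := Finsupp.linearCombination ℂ (fun e : FinRankIdempotent X => φ fun _ => e.1) with hL
  have hbound : ∃ M : ℝ, ∀ c, ‖L c‖ ≤ M * ‖j c‖ := hφ.exists_bound_linearCombination hn hBAP
  have hdense : DenseRange j := denseRange_linearCombination_finRankIdempotent
  have hΦ : ∀ e : FinRankIdempotent X, L.extendOfNorm j e.1 = φ fun _ => e.1 := by
    intro e
    simpa [hj, hL] using LinearMap.extendOfNorm_eq hdense hbound (Finsupp.single e 1)
  let pow : ↥(ApproxOps X) → ↥(ApproxOps X) := fun T => ⟨(T : X →L[ℂ] X) ^ n,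
    pow_mem_approxOps T.2 hn⟩
  have hpow : Continuous pow := by
    refine Continuous.subtype_mk ?_ _
    fun_prop
  have hdiag : ∀ T : ↥(ApproxOps X), IsFinRankDiagonal (T : X →L[ℂ] X) →
      φ (fun _ => T) = L.extendOfNorm j (pow T) := by
    intro T hT
    obtain ⟨s, e, horth, rfl⟩ := hT.exists_approxOps
    have hp : pow (∑ z ∈ s, z • (e z).1) = ∑ z ∈ s, z ^ n • (e z).1 := by
      ext1
      simp only [pow, Submodule.coe_sum, Submodule.coe_smul]
      exact sum_smul_pow_of_orthogonal s _ _ (fun z _ => (e z).2.2) horth hn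
    rw [hp, hφ.map_sum hn s (fun z => z • (e z).1), _root_.map_sum]
    · refine Finset.sum_congr rfl fun z _ => ?_
      rw [φ.map_const_smul, map_smul, hΦ]
    · intro z hz w hw hzw
      rw [Submodule.coe_smul, Submodule.coe_smul, smul_mul_smul_comm, horth z hz w hw hzw,
        smul_zero]
  refine ⟨L.extendOfNorm j, fun T Tn hTn => ?_, fun Ψ hΨ => ?_⟩
  · obtain rfl : Tn = pow T := Subtype.ext hTn
    have hclosed : IsClosed {T | φ (fun _ => T) = L.extendOfNorm j (pow T)} :=
      isClosed_eq (φ.cont.comp (by fun_prop)) ((L.extendOfNorm j).continuous.comp hpow)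
    exact closure_minimal (fun T hT => hdiag T hT) hclosed (mem_closure_isFinRankDiagonal_val T)
  · have hcomp : ⇑Ψ ∘ j = ⇑(L.extendOfNorm j) ∘ j := by
      have : Ψ.toLinearMap ∘ₗ j = (L.extendOfNorm j).toLinearMap ∘ₗ j := by
        ext e
        have he : ((e.1 : ↥(ApproxOps X)) : X →L[ℂ] X) = (e.1 : X →L[ℂ] X) ^ n :=
          ((show IsIdempotentElem (e.1 : X →L[ℂ] X) from e.2.2).pow_eq hn.ne').symm
        simpa [hj] using (hΨ e.1 e.1 he).symm.trans (hΦ e).symm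
      exact congrArg DFunLike.coe this
    exact DFunLike.coe_injective
      (hdense.equalizer Ψ.continuous (L.extendOfNorm j).continuous hcomp)

end Polynomial

/-- main theorem. If `X*` has the bounded approximation property
and `P : 𝓐(X) → Y` is a continuous orthogonally additive `n`-homogeneous
polynomial, then there is a unique continuous linear map `Φ : 𝓐(X) → Y` with
`P T = Φ (Tⁿ)` for all `T ∈ 𝓐(X)`. -/
theorem stmt15 {X Y : Type*} [NormedAddCommGroup X] [NormedSpace ℂ X] [CompleteSpace X]
    [NormedAddCommGroup Y] [NormedSpace ℂ Y] [CompleteSpace Y]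
    (hBAP : DualHasBAP X)
    (n : ℕ) (hn : 0 < n)
    (P : ↥(ApproxOps X) → Y)
    (φ : ContinuousMultilinearMap ℂ (fun _ : Fin n => ↥(ApproxOps X)) Y)
    (hP : ∀ T, P T = φ (fun _ => T))
    (horth : ∀ S T : ↥(ApproxOps X),
      (S : X →L[ℂ] X) * (T : X →L[ℂ] X) = 0 → (T : X →L[ℂ] X) * (S : X →L[ℂ] X) = 0 →
      P (S + T) = P S + P T) :
    ∃! Φ : ↥(ApproxOps X) →L[ℂ] Y,
      ∀ T Tn : ↥(ApproxOps X),
        (Tn : X →L[ℂ] X) = (T : X →L[ℂ] X) ^ n → P T = Φ Tn := by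
  obtain rfl : P = fun T => φ (fun _ => T) := funext hP
  exact IsOrthogonallyAdditive.existsUnique_linear horth hn hBAP
end
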